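/- There is a universal constant C such that for every weighted graph G=(V,E,w) on n ≥ 2 vertices with root r ∈ V, there exists an online group Steiner tree algorithm on G whose cost satisfies, for every request sequence and every t, w(H_t) ≤ C·(max_{i≤t}|g_i|)·log³n·OPT_t; that is, there is an O(N·log³n)-competitive online group Steiner tree algorithm on G, where N is the maximum group size. -/

import Mathlib

/-- An edge set `F` connects vertices `u` and `v` if they lie in the same connected
component of the graph with edge set `F`. -/
def EdgeConn {V : Type*} (F : Set (Sym2 V)) (u v : V) : Prop :=
  (SimpleGraph.fromEdgeSet F).Reachable u v

/-- Vertex sets `U` and `W` are connected by the edge set `F`. -/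
def SetConn {V : Type*} (F : Set (Sym2 V)) (U W : Set V) : Prop :=
  ∃ u ∈ U, ∃ w ∈ W, EdgeConn F u w

/-- A feasible group Steiner tree solution: an edge set of `G` connecting at least one
vertex of each group to the root `r`. -/
def GSTFeasible {V : Type*} (G : SimpleGraph V) (r : V) (gs : List (Set V))
    (H : Finset (Sym2 V)) : Prop :=
  ↑H ⊆ G.edgeSet ∧ ∀ g ∈ gs, SetConn (↑H) g {r}

/-- A group Steiner tree request sequence is valid when all its groups are nonempty. -/
def GSTValid {V : Type*} (gs : List (Set V)) : Prop := ∀ g ∈ gs, g.Nonempty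

/-- The laws of a distance on a set whose distinct points are at distance at least `1`. -/
structure IsUnitDist {V : Type*} (d : V → V → ℝ) : Prop where
  self : ∀ x, d x x = 0
  symm : ∀ x y, d x y = d y x
  triangle : ∀ x y z, d x z ≤ d x y + d y z
  one_le : ∀ x y, x ≠ y → 1 ≤ d x y

lemma IsUnitDist.nonneg {V : Type*} {d : V → V → ℝ} (hd : IsUnitDist d) (x y : V) :
    0 ≤ d x y := by
  by_cases h : x = y
  · rw [h, hd.self]
  · linarith [hd.one_le x y h]

/-- `lev` is a natural-number-valued ultrametric on `S`. -/
structure IsUltra {V : Type*} (S : Finset V) (lev : V → V → ℕ) : Prop where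
  eq_zero_iff : ∀ x ∈ S, ∀ y ∈ S, lev x y = 0 ↔ x = y
  symm : ∀ x ∈ S, ∀ y ∈ S, lev x y = lev y x
  ultra : ∀ x ∈ S, ∀ y ∈ S, ∀ z ∈ S, lev x z ≤ max (lev x y) (lev y z)

/-- In a finite sequence of numbers some consecutive ratio is at most the geometric mean. -/
lemma exists_ratio_le (k : ℕ) (b : ℕ → ℝ) (p q : ℝ)
    (hp : 0 < p) (hq : 0 < q) (hpk : p ^ k = b 0) (hqk : q ^ k = b k) (hk : 0 < k) :
    ∃ t < k, b (t + 1) * p ≤ b t * q := by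
  by_contra! hcon
  have key : ∀ t ≤ k, 0 < t → b 0 * q ^ t < b t * p ^ t := by
    intro t
    induction t with
    | zero => intro _ h; omega
    | succ t ih =>
      intro ht _
      have h1 := hcon t (by omega)
      rcases Nat.eq_zero_or_pos t with rfl | hpos
      · simpa using h1
      · have h2 := ih (by omega) hpos
        calc b 0 * q ^ (t + 1) = (b 0 * q ^ t) * q := by ring
          _ < (b t * p ^ t) * q := by gcongr
          _ = (b t * q) * p ^ t := by ring
          _ < (b (t + 1) * p) * p ^ t := by gcongr
          _ = b (t + 1) * p ^ (t + 1) := by ring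
  have h := key k le_rfl hk
  rw [hpk, hqk, mul_comm] at h
  exact lt_irrefl _ h

/-- Ultrametrics of diameter at most `m` on disjoint sets glue to one on the union, in which
points of different parts are at distance `m`. -/
lemma IsUltra.glue {V : Type*} [DecidableEq V] {S T : Finset V} {f g : V → V → ℕ}
    (hf : IsUltra S f) (hg : IsUltra T g) (hST : Disjoint S T) {m : ℕ} (hm : m ≠ 0)
    (hfm : ∀ x ∈ S, ∀ y ∈ S, f x y ≤ m) (hgm : ∀ x ∈ T, ∀ y ∈ T, g x y ≤ m) :
    IsUltra (S ∪ T) (fun x y => if x ∈ S ∧ y ∈ S then f x y else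
      if x ∈ T ∧ y ∈ T then g x y else m) := by
  have hdis : ∀ x, x ∈ S → x ∉ T := fun x hx => Finset.disjoint_left.1 hST hx
  refine ⟨?_, ?_, ?_⟩
  · intro x hx y hy
    have := hf.eq_zero_iff x
    have := hg.eq_zero_iff x
    rw [Finset.mem_union] at hx hy
    grind
  · intro x hx y hy
    have := hf.symm x
    have := hg.symm x
    rw [Finset.mem_union] at hx hy
    grind
  · intro x hx y hy z hz
    have := hf.ultra x
    have := hg.ultra x
    have := hfm x
    have := hgm x
    rw [Finset.mem_union] at hx hy hz
    have := hdis x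
    have := hdis y
    have := hdis z
    by_cases x ∈ S <;> by_cases y ∈ S <;> by_cases z ∈ S <;> simp_all

/-- If the balls of radius `2 ^ i` in `Y` have at most `M` points, then a fraction of at least
`M ^ (-1 / k)` of the points of `Y` carries an ultrametric, truncated at level `i + 1`, that
approximates the distance up to a factor proportional to `k`. -/
lemma exists_ultra_of_ball_card_le {V : Type*} [DecidableEq V] {d : V → V → ℝ}
    (hd : IsUnitDist d) (k : ℕ) (hk : 0 < k) (i : ℕ) (Y : Finset V) (M : ℕ)
    (hM : ∀ y ∈ Y, (Y.filter fun x => d y x ≤ 2 ^ i).card ≤ M) :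
    ∃ (S : Finset V) (lev : V → V → ℕ), S ⊆ Y ∧
      (Y.card : ℝ) ≤ S.card * (M : ℝ) ^ (1 / k : ℝ) ∧ IsUltra S lev ∧
      (∀ x ∈ S, ∀ y ∈ S, lev x y ≤ i + 1) ∧
      (∀ x ∈ S, ∀ y ∈ S, lev x y ≤ i → d x y ≤ 2 * 2 ^ lev x y) ∧
      (∀ x ∈ S, ∀ y ∈ S, x ≠ y → (2 : ℝ) ^ lev x y ≤ 4 * k * d x y) := by
  have hk0 : (k : ℝ) ≠ 0 := by positivity
  have hk1 : (1 : ℝ) ≤ k := by exact_mod_cast hk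
  induction i generalizing Y M with
  | zero =>
    refine ⟨Y, fun x y => if x = y then 0 else 1, le_rfl, ?_, ⟨?_, ?_, ?_⟩, ?_, ?_, ?_⟩
    · rcases Y.eq_empty_or_nonempty with rfl | ⟨y, hy⟩
      · simp
      · have h1 : 1 ≤ M := by
          refine le_trans ?_ (hM y hy)
          exact Finset.card_pos.2 ⟨y, by simp [hy, hd.self]⟩
        have : (1 : ℝ) ≤ (M : ℝ) ^ (1 / k : ℝ) :=
          Real.one_le_rpow (by exact_mod_cast h1) (by positivity)
        nlinarith [(Nat.cast_nonneg Y.card : (0 : ℝ) ≤ Y.card)]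
    · intros; simp
    · intros; grind
    · intros; grind
    · intros; grind
    · intro x _ y _ h
      have : x = y := by grind
      subst this
      simp [hd.self]
    · intro x _ y _ h
      have := hd.one_le x y h
      simp only [h, if_false, pow_one]
      nlinarith
  | succ i ih =>
    induction Y using Finset.strongInduction with
    | H Y ihY =>
    rcases Y.eq_empty_or_nonempty with rfl | hY
    · exact ⟨∅, fun _ _ => 0, by simp, by simp, ⟨by simp, by simp, by simp⟩, by simp, by simp,
        by simp⟩
    obtain ⟨c, hc, hmax⟩ := Finset.exists_max_image Y
      (fun y => (Y.filter fun x => d y x ≤ 2 ^ i).card) hY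
    set B : ℕ → Finset V := fun t => Y.filter fun x => d c x ≤ 2 ^ i * (1 + t / k) with hB
    have hcB : ∀ t, c ∈ B t := by
      intro t
      simp only [hB, Finset.mem_filter, hd.self]
      exact ⟨hc, by positivity⟩
    have hBpos : ∀ t, (0 : ℝ) < (B t).card := fun t => by
      exact_mod_cast Finset.card_pos.2 ⟨c, hcB t⟩
    have hB0 : B 0 = Y.filter fun x => d c x ≤ 2 ^ i := by simp [hB]
    have hBk : (B k).card ≤ M := by
      have : B k = Y.filter fun x => d c x ≤ 2 ^ (i + 1) := by
        simp only [hB, div_self hk0]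
        congr 1; ext x; rw [pow_succ]; norm_num
      rw [this]; exact hM c hc
    have hroot : ∀ t, (((B t).card : ℝ) ^ (1 / k : ℝ)) ^ k = (B t).card := fun t => by
      rw [one_div]; exact Real.rpow_inv_natCast_pow (hBpos t).le hk.ne'
    obtain ⟨t, htk, ht⟩ := exists_ratio_le k (fun t => ((B t).card : ℝ))
      _ _ (Real.rpow_pos_of_pos (hBpos 0) (1 / k : ℝ))
      (Real.rpow_pos_of_pos (hBpos k) (1 / k : ℝ)) (hroot 0) (hroot k) hk
    have hBY : ∀ t, B t ⊆ Y := fun t => Finset.filter_subset _ _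
    have hBsub : B t ⊆ B (t + 1) := by
      intro x hx
      simp only [hB, Finset.mem_filter] at hx ⊢
      refine ⟨hx.1, hx.2.trans ?_⟩
      push_cast
      gcongr
      linarith
    obtain ⟨S₁, f, hS₁, hcard₁, hf, hf1, hf2, hf3⟩ := ih (B t) (B 0).card (by
      intro y hy
      rw [hB0]
      refine le_trans (Finset.card_le_card ?_) (hmax y (hBY t hy))
      exact Finset.filter_subset_filter _ (hBY t))
    obtain ⟨S₂, g, hS₂, hcard₂, hg, hg1, hg2, hg3⟩ := ihY (Y \ B (t + 1))
      (Finset.sdiff_ssubset (hBY _) ⟨c, hcB _⟩) (by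
        intro y hy
        refine le_trans (Finset.card_le_card ?_) (hM y (Finset.sdiff_subset hy))
        exact Finset.filter_subset_filter _ Finset.sdiff_subset)
    have hdis : Disjoint S₁ S₂ := by
      rw [Finset.disjoint_left]
      intro x h1 h2
      exact (Finset.mem_sdiff.1 (hS₂ h2)).2 (hBsub (hS₁ h1))
    have hdiam : ∀ x ∈ S₁, ∀ y ∈ S₁, d x y ≤ 2 * 2 ^ (i + 1) := by
      have hr : ∀ x ∈ S₁, d c x ≤ 2 ^ (i + 1) := by
        intro x hx
        refine ((Finset.mem_filter.1 (hS₁ hx)).2).trans ?_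
        have : (t : ℝ) / k ≤ 1 := (div_le_one (by positivity)).2 (by exact_mod_cast htk.le)
        rw [pow_succ]
        gcongr
        linarith
      intro x hx y hy
      have := hd.triangle x c y
      rw [hd.symm x c] at this
      linarith [hr x hx, hr y hy]
    have hsep : ∀ x ∈ S₁, ∀ y ∈ S₂, (2 : ℝ) ^ (i + 2) ≤ 4 * k * d x y := by
      intro x hx y hy
      have h1 := (Finset.mem_filter.1 (hS₁ hx)).2
      have h2 := Finset.mem_sdiff.1 (hS₂ hy)
      have h3 : 2 ^ i * (1 + ((t + 1 : ℕ) : ℝ) / k) < d c y := by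
        by_contra! hle
        exact h2.2 (Finset.mem_filter.2 ⟨h2.1, hle⟩)
      have h4 := hd.triangle c x y
      have h5 : (2 : ℝ) ^ i / k ≤ d x y := by
        have : 2 ^ i * (1 + ((t + 1 : ℕ) : ℝ) / k) = 2 ^ i * (1 + (t : ℝ) / k) + 2 ^ i / k := by
          push_cast; ring
        linarith
      rw [div_le_iff₀ (by positivity)] at h5
      rw [pow_add]
      linarith
    refine ⟨S₁ ∪ S₂, _, Finset.union_subset (hS₁.trans (hBY t))
      (hS₂.trans Finset.sdiff_subset), ?_, hf.glue hg hdis (m := i + 2) (by omega)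
        (fun x hx y hy => (hf1 x hx y hy).trans (by omega)) hg1, ?_, ?_, ?_⟩
    · have hM' : ((B k).card : ℝ) ^ (1 / k : ℝ) ≤ (M : ℝ) ^ (1 / k : ℝ) :=
        Real.rpow_le_rpow (hBpos k).le (by exact_mod_cast hBk) (by positivity)
      have hY' : (Y.card : ℝ) = (B (t + 1)).card + (Y \ B (t + 1)).card := by
        rw [add_comm]; exact_mod_cast (Finset.card_sdiff_add_card_eq_card (hBY (t + 1))).symm
      rw [Finset.card_union_of_disjoint hdis, hY']
      have hp : (0 : ℝ) < ((B 0).card : ℝ) ^ (1 / k : ℝ) :=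
        Real.rpow_pos_of_pos (hBpos 0) (1 / k : ℝ)
      have hq : (0 : ℝ) < ((B k).card : ℝ) ^ (1 / k : ℝ) :=
        Real.rpow_pos_of_pos (hBpos k) (1 / k : ℝ)
      have h6 : ((B (t + 1)).card : ℝ) ≤ S₁.card * ((B k).card : ℝ) ^ (1 / k : ℝ) := by
        refine le_of_mul_le_mul_right ?_ hp
        calc _ ≤ _ := ht
          _ ≤ (S₁.card * ((B 0).card : ℝ) ^ (1 / k : ℝ)) * ((B k).card : ℝ) ^ (1 / k : ℝ) := by
            gcongr
          _ = _ := by ring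
      have h7 : (S₁.card : ℝ) * ((B k).card : ℝ) ^ (1 / k : ℝ) ≤
          S₁.card * (M : ℝ) ^ (1 / k : ℝ) := by gcongr
      push_cast
      linarith
    · intro x hx y hy
      have := hf1 x
      have := hg1 x
      grind
    · intro x hx y hy
      rw [Finset.mem_union] at hx hy
      by_cases h1 : x ∈ S₁ ∧ y ∈ S₁
      · simp only [h1, and_self, if_true]
        intro hle
        rcases (hf1 x h1.1 y h1.2).lt_or_eq with h | h
        · exact hf2 x h1.1 y h1.2 (by omega)
        · rw [h]; exact hdiam x h1.1 y h1.2
      · by_cases h2 : x ∈ S₂ ∧ y ∈ S₂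
        · simp only [h1, h2, and_self, if_true, if_false]
          exact hg2 x h2.1 y h2.2
        · simp only [h1, h2, if_false]
          omega
    · intro x hx y hy hxy
      rw [Finset.mem_union] at hx hy
      by_cases h1 : x ∈ S₁ ∧ y ∈ S₁
      · simp only [h1, and_self, if_true]
        exact hf3 x h1.1 y h1.2 hxy
      · by_cases h2 : x ∈ S₂ ∧ y ∈ S₂
        · simp only [h1, h2, and_self, if_true, if_false]
          exact hg3 x h2.1 y h2.2 hxy
        · simp only [h1, h2, if_false]
          by_cases h3 : x ∈ S₁
          · exact hsep x h3 y (by tauto)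
          · rw [hd.symm]
            exact hsep y (by tauto) x (by tauto)

/-- Every finite set contains at least half of its points as a subset on which the distance is
approximated by an ultrametric up to a factor logarithmic in the size of the set. -/
lemma exists_ultra_half {V : Type*} [Fintype V] [DecidableEq V] {d : V → V → ℝ}
    (hd : IsUnitDist d) (k : ℕ) (hk : 0 < k) (U : Finset V) (hU : U.card ≤ 2 ^ k) :
    ∃ (S : Finset V) (lev : V → V → ℕ), S ⊆ U ∧ U.card ≤ 2 * S.card ∧ IsUltra S lev ∧
      (∀ x ∈ S, ∀ y ∈ S, d x y ≤ 2 * 2 ^ lev x y) ∧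
      (∀ x ∈ S, ∀ y ∈ S, x ≠ y → (2 : ℝ) ^ lev x y ≤ 4 * k * d x y) := by
  obtain ⟨R, hR⟩ : ∃ R : ℝ, ∀ p : V × V, 4 * k * d p.1 p.2 ≤ R := by
    obtain ⟨R, hR⟩ := (Set.finite_range fun p : V × V => 4 * k * d p.1 p.2).bddAbove
    exact ⟨R, fun p => hR ⟨p, rfl⟩⟩
  obtain ⟨i, hi⟩ := pow_unbounded_of_one_lt R (one_lt_two : (1 : ℝ) < 2)
  obtain ⟨S, lev, hSU, hcard, hlev, -, h2, h3⟩ := exists_ultra_of_ball_card_le hd k hk i U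
    (2 ^ k) (fun y _ => (Finset.card_le_card (Finset.filter_subset _ _)).trans hU)
  refine ⟨S, lev, hSU, ?_, hlev, ?_, h3⟩
  · have : ((2 ^ k : ℕ) : ℝ) ^ (1 / k : ℝ) = 2 := by
      push_cast
      rw [one_div]
      exact Real.pow_rpow_inv_natCast (by norm_num) hk.ne'
    rw [this, mul_comm] at hcard
    exact_mod_cast hcard
  · intro x hx y hy
    refine h2 x hx y hy ?_
    by_cases hxy : x = y
    · rw [(hlev.eq_zero_iff x hx y hy).2 hxy]
      omega
    · have : (2 : ℝ) ^ lev x y < 2 ^ i := (h3 x hx y hy hxy).trans_lt ((hR (x, y)).trans_lt hi)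
      exact ((pow_lt_pow_iff_right₀ (one_lt_two : (1 : ℝ) < 2)).1 this).le

/-- An ultrametric approximating a distance extends to one more point. -/
lemma IsUltra.exists_insert {V : Type*} [DecidableEq V] {d : V → V → ℝ} (hd : IsUnitDist d)
    {S : Finset V} {lev : V → V → ℕ} (hlev : IsUltra S lev) {D : ℝ} (hD : 1 ≤ D)
    (h1 : ∀ x ∈ S, ∀ y ∈ S, d x y ≤ 2 * 2 ^ lev x y)
    (h2 : ∀ x ∈ S, ∀ y ∈ S, x ≠ y → (2 : ℝ) ^ lev x y ≤ D * d x y) (r : V) :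
    ∃ lev' : V → V → ℕ, IsUltra (insert r S) lev' ∧
      (∀ x ∈ insert r S, ∀ y ∈ insert r S, d x y ≤ 3 * 2 ^ lev' x y) ∧
      (∀ x ∈ insert r S, ∀ y ∈ insert r S, x ≠ y → (2 : ℝ) ^ lev' x y ≤ 2 * D * d x y) := by
  by_cases hr : r ∈ S
  · rw [Finset.insert_eq_of_mem hr]
    refine ⟨lev, hlev, fun x hx y hy => (h1 x hx y hy).trans (by gcongr; norm_num),
      fun x hx y hy hxy => (h2 x hx y hy hxy).trans ?_⟩
    nlinarith [mul_nonneg (zero_le_one.trans hD) (hd.nonneg x y)]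
  rcases S.eq_empty_or_nonempty with rfl | hS
  · exact ⟨fun _ _ => 0, ⟨by simp, by simp, by simp⟩, by simp [hd.self], by simp⟩
  obtain ⟨c, hc, hmin⟩ := Finset.exists_min_image S (fun v => d r v) hS
  have hrc : r ≠ c := fun h => hr (h ▸ hc)
  obtain ⟨a, ha1, ha2⟩ := exists_nat_pow_near (hd.one_le r c hrc) (one_lt_two : (1 : ℝ) < 2)
  set p : V → V := fun v => if v = r then c else v with hp
  set h : V → ℕ := fun v => if v = r then a + 1 else 0 with hh
  set f : V → V → ℕ := fun x y => if x = y then 0 else max (lev (p x) (p y)) (max (h x) (h y))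
    with hf
  have hpS : ∀ x ∈ insert r S, p x ∈ S := by
    intro x hx
    simp only [hp]
    rw [Finset.mem_insert] at hx
    grind
  have hpx : ∀ x ∈ S, p x = x := by intro x hx; simp only [hp]; grind
  have hhx : ∀ x ∈ S, h x = 0 := by intro x hx; simp only [hh]; grind
  have hpr : p r = c := by simp [hp]
  have hhr : h r = a + 1 := by simp [hh]
  have hfs : ∀ x ∈ insert r S, ∀ y ∈ insert r S, f x y = f y x := by
    intro x hx y hy
    have := hlev.symm _ (hpS x hx) _ (hpS y hy)
    simp only [hf, this, eq_comm (a := x), max_comm (h x)]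
  have hfS : ∀ x ∈ S, ∀ y ∈ S, f x y = lev x y := by
    intro x hx y hy
    simp only [hf, hpx x hx, hpx y hy, hhx x hx, hhx y hy]
    split_ifs with hxy
    · exact ((hlev.eq_zero_iff x hx y hy).2 hxy).symm
    · simp
  have hfr : ∀ y ∈ S, f r y = max (lev c y) (a + 1) := by
    intro y hy
    have : r ≠ y := fun h => hr (h ▸ hy)
    simp [hf, this, hpr, hhr, hpx y hy, hhx y hy]
  have hr1 : ∀ y ∈ S, d r y ≤ 3 * 2 ^ f r y := by
    intro y hy
    rw [hfr y hy]
    have e1 : (2 : ℝ) ^ lev c y ≤ 2 ^ max (lev c y) (a + 1) :=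
      pow_le_pow_right₀ one_le_two (le_max_left _ _)
    have e2 : (2 : ℝ) ^ (a + 1) ≤ 2 ^ max (lev c y) (a + 1) :=
      pow_le_pow_right₀ one_le_two (le_max_right _ _)
    linarith [hd.triangle r c y, h1 c hc y hy]
  have hr2 : ∀ y ∈ S, (2 : ℝ) ^ f r y ≤ 2 * D * d r y := by
    intro y hy
    rw [hfr y hy]
    have hm := hmin y hy
    have hry : 1 ≤ d r y := hd.one_le r y fun h => hr (h ▸ hy)
    have h0 : d r y ≤ D * d r y := le_mul_of_one_le_left (by linarith) hD
    rcases max_choice (lev c y) (a + 1) with h | h <;> rw [h]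
    · by_cases hcy : c = y
      · rw [(hlev.eq_zero_iff c hc y hy).2 hcy]
        simp only [pow_zero]
        nlinarith
      · have h3 := hd.triangle c r y
        rw [hd.symm c r] at h3
        have h4 : D * d c y ≤ D * (2 * d r y) := by gcongr; linarith
        linarith [h2 c hc y hy hcy]
    · rw [pow_succ]
      linarith
  refine ⟨f, ⟨?_, hfs, ?_⟩, ?_, ?_⟩
  · intro x hx y hy
    refine ⟨fun h0 => ?_, fun h0 => by simp [hf, h0]⟩
    by_contra hne
    have hx' := Finset.mem_insert.1 hx
    have hy' := Finset.mem_insert.1 hy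
    simp only [hf, hne, if_false] at h0
    rcases hx' with rfl | hx'
    · omega
    rcases hy' with rfl | hy'
    · omega
    rw [hpx x hx', hpx y hy'] at h0
    exact hne ((hlev.eq_zero_iff x hx' y hy').1 (by omega))
  · intro x hx y hy z hz
    have := hlev.ultra _ (hpS x hx) _ (hpS y hy) _ (hpS z hz)
    by_cases hxz : x = z
    · simp [hf, hxz]
    by_cases hxy : x = y
    · simp [hxy]
    by_cases hyz : y = z
    · simp [hyz]
    simp only [hf, hxz, hxy, hyz, if_false]
    omega
  · intro x hx y hy
    rcases Finset.mem_insert.1 hx with rfl | hx' <;> rcases Finset.mem_insert.1 hy with rfl | hy'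
    · rw [hd.self]; positivity
    · exact hr1 y hy'
    · rw [hd.symm, hfs x hx y hy]; exact hr1 x hx'
    · rw [hfS x hx' y hy']
      exact (h1 x hx' y hy').trans (by gcongr; norm_num)
  · intro x hx y hy hxy
    rcases Finset.mem_insert.1 hx with rfl | hx' <;> rcases Finset.mem_insert.1 hy with rfl | hy'
    · exact absurd rfl hxy
    · exact hr2 y hy'
    · rw [hd.symm, hfs x hx y hy]; exact hr2 x hx'
    · rw [hfS x hx' y hy']
      refine (h2 x hx' y hy' hxy).trans ?_
      nlinarith [mul_nonneg (zero_le_one.trans hD) (hd.nonneg x y)]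

/-- An ultrametric approximating a distance yields a system of root paths: an item `e : ℕ × V`
is a link from `e.2` to `nxt e`, the links of `path v` lead from `v` to the root, and the paths
of close points differ in cheap items only. -/
lemma IsUltra.exists_paths {V : Type*} [DecidableEq V] {d : V → V → ℝ} (hd : IsUnitDist d)
    {S : Finset V} {lev : V → V → ℕ} (hlev : IsUltra S lev) {D : ℝ}
    (h1 : ∀ x ∈ S, ∀ y ∈ S, d x y ≤ 3 * 2 ^ lev x y)
    (h2 : ∀ x ∈ S, ∀ y ∈ S, x ≠ y → (2 : ℝ) ^ lev x y ≤ D * d x y) {r : V} (hr : r ∈ S) :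
    ∃ (nxt : ℕ × V → V) (path : V → Finset (ℕ × V)), path r = ∅ ∧
      (∀ v ∈ S, ∀ H : Set (Sym2 V), (∀ e ∈ path v, EdgeConn H e.2 (nxt e)) → EdgeConn H v r) ∧
      (∀ x ∈ S, ∀ y ∈ S, ∑ e ∈ path y \ path x, d e.2 (nxt e) ≤ 6 * D * d x y) := by
  classical
  have hself : ∀ x ∈ S, lev x x = 0 := fun x hx => (hlev.eq_zero_iff x hx x hx).2 rfl
  set rep : ℕ → V → V := fun i v => if lev v r ≤ i then r else
    @Classical.epsilon V ⟨r⟩ (fun u => u ∈ S ∧ lev v u ≤ i) with hrep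
  have hspec : ∀ i, ∀ v ∈ S, rep i v ∈ S ∧ lev v (rep i v) ≤ i := by
    intro i v hv
    simp only [hrep]
    split_ifs with h
    · exact ⟨hr, h⟩
    · exact @Classical.epsilon_spec V (fun u => u ∈ S ∧ lev v u ≤ i)
        ⟨v, hv, by simp [hself v hv]⟩
  have hle : ∀ i, ∀ x ∈ S, ∀ y ∈ S, ∀ z ∈ S, lev x y ≤ i → (lev x z ≤ i ↔ lev y z ≤ i) := by
    intro i x hx y hy z hz h
    have e1 := hlev.ultra x hx y hy z hz
    have e2 := hlev.ultra y hy x hx z hz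
    have e3 := hlev.symm x hx y hy
    omega
  have hcongr : ∀ i, ∀ x ∈ S, ∀ y ∈ S, lev x y ≤ i → rep i x = rep i y := by
    intro i x hx y hy h
    have e1 : (fun u => u ∈ S ∧ lev x u ≤ i) = (fun u => u ∈ S ∧ lev y u ≤ i) := by
      funext u
      exact propext (and_congr_right fun hu => hle i x hx y hy u hu h)
    simp only [hrep, e1, hle i x hx y hy r hr h]
  have hnext : ∀ i, ∀ v ∈ S, rep (i + 1) (rep i v) = rep (i + 1) v := by
    intro i v hv
    exact (hcongr (i + 1) v hv _ (hspec i v hv).1 ((hspec i v hv).2.trans (by omega))).symm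
  refine ⟨fun e => rep (e.1 + 1) e.2, fun v => (Finset.range (lev v r)).image
    fun i => (i, rep i v), by simp [hself r hr], ?_, ?_⟩
  · intro v hv H hH
    have hstep : ∀ i ≤ lev v r, EdgeConn H v (rep i v) := by
      intro i
      induction i with
      | zero =>
        intro _
        have := (hspec 0 v hv)
        rw [← (hlev.eq_zero_iff v hv _ this.1).1 (by omega)]
        exact SimpleGraph.Reachable.refl v
      | succ i ih =>
        intro hi
        have := hH (i, rep i v) (Finset.mem_image_of_mem _ (Finset.mem_range.2 (by omega)))
        simp only [hnext i v hv] at this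
        exact (ih (by omega)).trans this
    have := hstep _ le_rfl
    simpa [hrep] using this
  · intro x hx y hy
    have hsub : ((Finset.range (lev y r)).image fun i => (i, rep i y)) \
        ((Finset.range (lev x r)).image fun i => (i, rep i x)) ⊆
        (Finset.range (lev x y)).image fun i => (i, rep i y) := by
      intro e he
      rw [Finset.mem_sdiff, Finset.mem_image] at he
      obtain ⟨⟨i, hi, rfl⟩, hn⟩ := he
      refine Finset.mem_image_of_mem _ (Finset.mem_range.2 ?_)
      by_contra! hc
      apply hn
      rw [← hcongr i x hx y hy hc]
      refine Finset.mem_image_of_mem _ (Finset.mem_range.2 ?_)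
      have := hle i x hx y hy r hr hc
      have := Finset.mem_range.1 hi
      omega
    by_cases hxy : x = y
    · subst hxy; simp [hd.self]
    calc _ ≤ ∑ e ∈ (Finset.range (lev x y)).image fun i => (i, rep i y),
            d e.2 (rep (e.1 + 1) e.2) :=
          Finset.sum_le_sum_of_subset_of_nonneg hsub fun _ _ _ => hd.nonneg _ _
      _ = ∑ i ∈ Finset.range (lev x y), d (rep i y) (rep (i + 1) (rep i y)) :=
          Finset.sum_image fun a _ b _ h => (Prod.ext_iff.1 h).1
      _ ≤ ∑ i ∈ Finset.range (lev x y), 6 * (2 : ℝ) ^ i := by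
          refine Finset.sum_le_sum fun i _ => ?_
          rw [hnext i y hy]
          obtain ⟨e1, e2⟩ := hspec i y hy
          obtain ⟨e3, e4⟩ := hspec (i + 1) y hy
          refine (h1 _ e1 _ e3).trans ?_
          have : lev (rep i y) (rep (i + 1) y) ≤ i + 1 := by
            have e5 := hlev.ultra _ e1 y hy _ e3
            have e6 := hlev.symm y hy _ e1
            omega
          calc (3 : ℝ) * 2 ^ lev (rep i y) (rep (i + 1) y) ≤ 3 * 2 ^ (i + 1) := by
                gcongr; norm_num
            _ = 6 * 2 ^ i := by ring
      _ ≤ 6 * 2 ^ lev x y := by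
          rw [← Finset.mul_sum, geom_sum_eq (by norm_num)]
          norm_num
      _ ≤ 6 * (D * d x y) := by gcongr; exact h2 x hx y hy hxy
      _ = 6 * D * d x y := by ring

/-- The length of the sequence of points `x, l₀, l₁, …`. -/
def tourLength {V : Type*} (d : V → V → ℝ) : V → List V → ℝ
  | _, [] => 0
  | x, y :: l => d x y + tourLength d y l

lemma exists_tour_insert {V : Type*} {d : V → V → ℝ} (hd : IsUnitDist d) {u : V} (v : V)
    (r : V) (l : List V) (hu : u ∈ r :: l) :
    ∃ l' : List V, (∀ x, x ∈ r :: l' ↔ x = v ∨ x ∈ r :: l) ∧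
      tourLength d r l' = tourLength d r l + 2 * d u v := by
  induction l generalizing r with
  | nil =>
    obtain rfl : u = r := by simpa using hu
    refine ⟨[v, u], fun x => by simp; tauto, ?_⟩
    simp only [tourLength, hd.symm v u]
    ring
  | cons a l ih =>
    by_cases hur : u = r
    · subst hur
      refine ⟨v :: u :: a :: l, fun x => by simp; tauto, ?_⟩
      simp only [tourLength, hd.symm v u]
      ring
    · obtain ⟨l', h1, h2⟩ := ih a (by simpa [hur] using hu)
      refine ⟨a :: l', fun x => ?_, ?_⟩
      · rw [List.mem_cons, h1, List.mem_cons (a := x) (b := r)]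
        tauto
      · simp only [tourLength, h2]
        ring

/-- The component of `r` in a finite edge set is covered by a tour of at most twice its weight. -/
lemma exists_tour {V : Type*} [DecidableEq V] {d : V → V → ℝ} (hd : IsUnitDist d)
    {w : Sym2 V → ℝ} (F : Finset (Sym2 V)) (hw : ∀ e ∈ F, 0 ≤ w e)
    (hdw : ∀ u v, s(u, v) ∈ F → d u v ≤ w s(u, v)) (r : V) :
    ∃ l : List V, (∀ v, EdgeConn (↑F) v r → v ∈ r :: l) ∧
      tourLength d r l ≤ 2 * ∑ e ∈ F, w e := by
  classical
  set good : Finset (Finset (Sym2 V)) := F.powerset.filter fun F₀ => ∃ l : List V,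
    (∀ e ∈ F₀, ∀ v ∈ e, v ∈ r :: l) ∧ tourLength d r l ≤ 2 * ∑ e ∈ F₀, w e with hgood
  obtain ⟨F₀, hF₀, hmax⟩ := Finset.exists_max_image good Finset.card
    ⟨∅, by simp only [hgood, Finset.mem_filter]; exact ⟨by simp, [], by simp, by simp [tourLength]⟩⟩
  obtain ⟨hsub, l, hl, hlen⟩ := Finset.mem_filter.1 hF₀
  rw [Finset.mem_powerset] at hsub
  refine ⟨l, ?_, hlen.trans ?_⟩
  · have hclosed : ∀ u v, (SimpleGraph.fromEdgeSet (F : Set (Sym2 V))).Adj u v →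
        u ∈ r :: l → v ∈ r :: l := by
      intro u v huv hu
      rw [SimpleGraph.fromEdgeSet_adj, Finset.mem_coe] at huv
      by_contra hv
      have hnot : s(u, v) ∉ F₀ := fun h => hv (hl _ h v (Sym2.mem_mk_right u v))
      obtain ⟨l', h1, h2⟩ := exists_tour_insert hd v r l hu
      have hmem : insert s(u, v) F₀ ∈ good := by
        refine Finset.mem_filter.2 ⟨Finset.mem_powerset.2
          (Finset.insert_subset huv.1 hsub), l', ?_, ?_⟩
        · intro e he x hx
          rw [h1]
          rcases Finset.mem_insert.1 he with rfl | he
          · rcases Sym2.mem_iff.1 hx with rfl | rfl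
            · exact Or.inr hu
            · exact Or.inl rfl
          · exact Or.inr (hl e he x hx)
        · rw [h2, Finset.sum_insert hnot]
          linarith [hdw u v huv.1]
      have := hmax _ hmem
      rw [Finset.card_insert_of_notMem hnot] at this
      omega
    intro v hv
    obtain ⟨p⟩ := SimpleGraph.Reachable.symm hv
    have hwalk : ∀ a b, (SimpleGraph.fromEdgeSet (F : Set (Sym2 V))).Walk a b →
        a ∈ r :: l → b ∈ r :: l := by
      intro a b q
      induction q with
      | nil => exact id
      | cons h _ ih => exact fun ha => ih (hclosed _ _ h ha)
    exact hwalk _ _ p (by simp)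
  · have := Finset.sum_le_sum_of_subset_of_nonneg hsub (f := w) fun e he _ => hw e he
    linarith

/-- If the item sets of two points differ by at most `K` times their distance, then the item
sets of the points of `S` on a tour cost at most `K` times its length. -/
lemma sum_biUnion_le_tourLength {V ι : Type*} [DecidableEq V] [DecidableEq ι] {d : V → V → ℝ}
    (hd : IsUnitDist d) {S : Finset V} {c : ι → ℝ} (hc : ∀ e, 0 ≤ c e) {path : V → Finset ι}
    {K : ℝ} (hK : 0 ≤ K)
    (h : ∀ x ∈ S, ∀ y ∈ S, ∑ e ∈ path y \ path x, c e ≤ K * d x y) (l : List V) (x u : V)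
    (hx : x ∈ S) :
    ∑ e ∈ (l.toFinset ∩ S).biUnion path \ path x, c e ≤ K * (d x u + tourLength d u l) := by
  induction l generalizing x u with
  | nil =>
    simp only [List.toFinset_nil, Finset.empty_inter, Finset.biUnion_empty, Finset.empty_sdiff,
      Finset.sum_empty, tourLength]
    exact mul_nonneg hK (by linarith [hd.nonneg x u])
  | cons v l ih =>
    have htri := mul_le_mul_of_nonneg_left (hd.triangle x u v) hK
    simp only [tourLength]
    by_cases hv : v ∈ S
    · have hsub : ((v :: l).toFinset ∩ S).biUnion path \ path x ⊆
          (path v \ path x) ∪ ((l.toFinset ∩ S).biUnion path \ path v) := by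
        intro e
        simp only [List.toFinset_cons, Finset.mem_sdiff, Finset.mem_biUnion, Finset.mem_union,
          Finset.mem_inter, Finset.mem_insert]
        grind
      have h1 := Finset.sum_le_sum_of_subset_of_nonneg hsub (f := c) fun e _ _ => hc e
      have h2 := Finset.sum_union_inter (s₁ := path v \ path x)
        (s₂ := (l.toFinset ∩ S).biUnion path \ path v) (f := c)
      have h5 := Finset.sum_nonneg fun e (_ : e ∈ (path v \ path x) ∩
        ((l.toFinset ∩ S).biUnion path \ path v)) => hc e
      have h3 := ih v v hv
      have h4 := h x hx v hv
      rw [hd.self] at h3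
      linarith
    · have he : (v :: l).toFinset ∩ S = l.toFinset ∩ S := by
        rw [List.toFinset_cons, Finset.insert_inter_of_notMem hv]
      rw [he]
      linarith [ih x v hx]

/-- The invariant of the primal-dual algorithm for online covering: the bought items `B` are
paid for by a dual solution of value `D`, which is a lower bound for the solutions in `Φ`. -/
def DualPaid {ι : Type*} (c : ι → ℝ) (Φ : Set (Finset ι)) (M : ℝ) (B : Finset ι) : Prop :=
  ∃ (load : ι → ℝ) (D : ℝ), 0 ≤ D ∧ (∀ e, load e ≤ c e) ∧ (∀ e ∈ B, load e = c e) ∧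
    (∀ E : Finset ι, ∑ e ∈ E, load e ≤ M * D) ∧ ∀ F ∈ Φ, D ≤ ∑ e ∈ F, load e

lemma DualPaid.mono {ι : Type*} {c : ι → ℝ} {Φ Ψ : Set (Finset ι)} {M N : ℝ} {B : Finset ι}
    (h : DualPaid c Φ M B) (hΨ : Ψ ⊆ Φ) (hMN : M ≤ N) : DualPaid c Ψ N B := by
  obtain ⟨load, D, h0, h1, h2, h3, h4⟩ := h
  exact ⟨load, D, h0, h1, h2, fun E => (h3 E).trans (mul_le_mul_of_nonneg_right hMN h0),
    fun F hF => h4 F (hΨ hF)⟩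

lemma DualPaid.sum_le {ι : Type*} {c : ι → ℝ} {Φ : Set (Finset ι)} {M : ℝ} (hM : 0 ≤ M)
    {B : Finset ι} (h : DualPaid c Φ M B) {F : Finset ι} (hF : F ∈ Φ) :
    ∑ e ∈ B, c e ≤ M * ∑ e ∈ F, c e := by
  obtain ⟨load, D, h0, h1, h2, h3, h4⟩ := h
  calc ∑ e ∈ B, c e = ∑ e ∈ B, load e := Finset.sum_congr rfl fun e he => (h2 e he).symm
    _ ≤ M * D := h3 B
    _ ≤ M * ∑ e ∈ F, c e := by
      gcongr
      exact (h4 F hF).trans (Finset.sum_le_sum fun e _ => h1 e)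

/-- Serving one request that asks for all items of one of at most `M` item sets. -/
lemma DualPaid.exists_serve {ι : Type*} [DecidableEq ι] {c : ι → ℝ} {Φ : Set (Finset ι)}
    {M : ℝ} (paths : Finset (Finset ι)) (hne : paths.Nonempty) (hcard : (paths.card : ℝ) ≤ M)
    (hΦ : ∀ F ∈ Φ, ∃ p ∈ paths, p ⊆ F) (B : Finset ι) (h : DualPaid c Φ M B) :
    ∃ B', B ⊆ B' ∧ DualPaid c Φ M B' ∧ ∃ p ∈ paths, p ⊆ B' := by
  by_cases hdone : ∃ p ∈ paths, p ⊆ B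
  · exact ⟨B, le_rfl, h, hdone⟩
  have hpick : ∀ p : Finset ι, ∃ e, p ∈ paths → e ∈ p ∧ e ∉ B := by
    intro p
    by_cases hp : p ∈ paths
    · obtain ⟨e, he⟩ := Finset.not_subset.1 fun hpB => hdone ⟨p, hp, hpB⟩
      exact ⟨e, fun _ => he⟩
    · obtain ⟨q, hq⟩ := hne
      obtain ⟨e, -⟩ := Finset.not_subset.1 fun hpB => hdone ⟨q, hq, hpB⟩
      exact ⟨e, fun h => absurd h hp⟩
  choose pick hpick using hpick
  have hpickB : ∀ e ∈ paths.image pick, e ∉ B := by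
    intro e he
    obtain ⟨p, hp, rfl⟩ := Finset.mem_image.1 he
    exact (hpick p hp).2
  obtain ⟨load, D, h0, h1, h2, h3, h4⟩ := h
  obtain ⟨a, ha, hmin⟩ := Finset.exists_min_image (paths.image pick) (fun e => c e - load e)
    (hne.image pick)
  have hδ : 0 ≤ c a - load a := sub_nonneg.2 (h1 a)
  have hsum : ∀ E : Finset ι, ∑ e ∈ E, (load e + if e ∈ paths.image pick then c a - load a else 0)
      = ∑ e ∈ E, load e + (E ∩ paths.image pick).card * (c a - load a) := by
    intro E
    rw [Finset.sum_add_distrib, ← Finset.sum_filter, Finset.sum_const, nsmul_eq_mul,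
      Finset.filter_mem_eq_inter]
  have hB' : DualPaid c Φ M (insert a B) := by
    refine ⟨fun e => load e + if e ∈ paths.image pick then c a - load a else 0,
      D + (c a - load a), by linarith, ?_, ?_, ?_, ?_⟩
    · intro e
      dsimp only
      split_ifs with he
      · linarith [hmin e he]
      · linarith [h1 e]
    · intro e he
      rcases Finset.mem_insert.1 he with rfl | he
      · simp only [ha, if_true]; ring
      · have : e ∉ paths.image pick := fun h => hpickB e h he
        simp only [this, if_false, h2 e he, add_zero]
    · intro E
      rw [hsum, mul_add]
      have : ((E ∩ paths.image pick).card : ℝ) ≤ M := by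
        refine le_trans ?_ hcard
        exact_mod_cast (Finset.card_le_card Finset.inter_subset_right).trans Finset.card_image_le
      have := mul_le_mul_of_nonneg_right this hδ
      linarith [h3 E]
    · intro F hF
      rw [hsum]
      obtain ⟨p, hp, hpF⟩ := hΦ F hF
      have : (1 : ℝ) ≤ (F ∩ paths.image pick).card := by
        exact_mod_cast Finset.card_pos.2 ⟨pick p, Finset.mem_inter.2
          ⟨hpF (hpick p hp).1, Finset.mem_image_of_mem _ hp⟩⟩
      have := mul_le_mul_of_nonneg_right this hδ
      linarith [h4 F hF]
  obtain ⟨p, hp, hpa⟩ := Finset.mem_image.1 ha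
  have hdec : (paths.biUnion id \ insert a B).card < (paths.biUnion id \ B).card := by
    refine Finset.card_lt_card ⟨Finset.sdiff_subset_sdiff le_rfl (Finset.subset_insert a B), ?_⟩
    intro hsub
    have := hsub (Finset.mem_sdiff.2 ⟨Finset.mem_biUnion.2 ⟨p, hp, hpa ▸ (hpick p hp).1⟩,
      hpickB a ha⟩)
    exact (Finset.mem_sdiff.1 this).2 (Finset.mem_insert_self a B)
  obtain ⟨B', hBB', hrest⟩ := DualPaid.exists_serve paths hne hcard hΦ (insert a B) hB'
  exact ⟨B', (Finset.subset_insert a B).trans hBB', hrest⟩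
termination_by (paths.biUnion id \ B).card

/-- Online choice: an invariant that can be maintained step by step is maintained by a function
of the request sequence. -/
lemma exists_online {α β : Type*} [Preorder β] (valid : List α → Prop) (R : List α → β → Prop)
    (hvalid : ∀ l a, valid (l ++ [a]) → valid l) (b₀ : β) (h₀ : R [] b₀)
    (hstep : ∀ l a b, valid (l ++ [a]) → R l b → ∃ b', b ≤ b' ∧ R (l ++ [a]) b') :
    ∃ A : List α → β, (∀ l a, A l ≤ A (l ++ [a])) ∧ ∀ l, valid l → R l (A l) := by
  classical
  let f : List α → β := fun l => List.rec (motive := fun _ => β) b₀ (fun a l b =>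
    if h : ∃ b', b ≤ b' ∧ R (l.reverse ++ [a]) b' then h.choose else b) l
  have hf : ∀ (a : α) (l : List α), f (a :: l) =
      if h : ∃ b', f l ≤ b' ∧ R (l.reverse ++ [a]) b' then h.choose else f l := fun _ _ => rfl
  have hA : ∀ l a, f (l ++ [a]).reverse = if h : ∃ b', f l.reverse ≤ b' ∧ R (l ++ [a]) b' then
      h.choose else f l.reverse := by
    intro l a
    rw [List.reverse_concat, hf]
    simp only [List.reverse_reverse]
  refine ⟨fun l => f l.reverse, fun l a => ?_, fun l => ?_⟩
  · dsimp only
    rw [hA]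
    split_ifs with h
    · exact h.choose_spec.1
    · exact le_rfl
  · induction l using List.reverseRecOn with
    | nil => exact fun _ => h₀
    | append_singleton l a ih =>
      intro hv
      have h := hstep l a _ hv (ih (hvalid l a hv))
      dsimp only
      rw [hA, dif_pos h]
      exact h.choose_spec.2

lemma Finset.sum_biUnion_le_sum {α β : Type*} [DecidableEq β] (s : Finset α)
    (t : α → Finset β) (f : β → ℝ) (hf : ∀ a ∈ s, ∀ e ∈ t a, 0 ≤ f e) :
    ∑ e ∈ s.biUnion t, f e ≤ ∑ a ∈ s, ∑ e ∈ t a, f e := by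
  classical
  induction s using Finset.induction_on with
  | empty => simp
  | insert a s ha ih =>
    rw [Finset.biUnion_insert, Finset.sum_insert ha]
    have h1 := Finset.sum_union_inter (s₁ := t a) (s₂ := s.biUnion t) (f := f)
    have h2 : 0 ≤ ∑ e ∈ t a ∩ s.biUnion t, f e := Finset.sum_nonneg fun e he =>
      hf a (Finset.mem_insert_self a s) e (Finset.mem_inter.1 he).1
    linarith [ih fun b hb => hf b (Finset.mem_insert_of_mem hb)]

lemma EdgeConn.mono {V : Type*} {F H : Set (Sym2 V)} (hFH : F ⊆ H) {u v : V}
    (h : EdgeConn F u v) : EdgeConn H u v :=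
  SimpleGraph.Reachable.mono (SimpleGraph.fromEdgeSet_mono hFH) h

/-- Cheapest connections between the vertices of a weighted graph define a distance. -/
lemma exists_shortest_connection {V : Type*} [Fintype V] [DecidableEq V] {G : SimpleGraph V}
    {w : Sym2 V → ℝ} (hG : G.Connected) (hw : ∀ e ∈ G.edgeSet, 1 ≤ w e) :
    ∃ Q : V → V → Finset (Sym2 V), (∀ x y, (↑(Q x y) : Set (Sym2 V)) ⊆ G.edgeSet) ∧
      (∀ x y, EdgeConn (↑(Q x y)) x y) ∧ IsUnitDist (fun x y => ∑ e ∈ Q x y, w e) ∧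
      ∀ u v, s(u, v) ∈ G.edgeSet → ∑ e ∈ Q u v, w e ≤ w s(u, v) := by
  classical
  have hex : ∀ x y, ∃ P : Finset (Sym2 V), ((↑P : Set (Sym2 V)) ⊆ G.edgeSet ∧
      EdgeConn (↑P : Set (Sym2 V)) x y) ∧ ∀ P' : Finset (Sym2 V), (↑P' : Set (Sym2 V)) ⊆ G.edgeSet →
        EdgeConn (↑P' : Set (Sym2 V)) x y → ∑ e ∈ P, w e ≤ ∑ e ∈ P', w e := by
    intro x y
    obtain ⟨P, hP, hmin⟩ := Finset.exists_min_image (Finset.univ.filter fun P : Finset (Sym2 V) =>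
      (↑P : Set (Sym2 V)) ⊆ G.edgeSet ∧ EdgeConn (↑P : Set (Sym2 V)) x y) (fun P => ∑ e ∈ P, w e)
      ⟨G.edgeFinset, Finset.mem_filter.2 ⟨Finset.mem_univ _, by simp, by
        simpa [EdgeConn] using hG.preconnected x y⟩⟩
    exact ⟨P, (Finset.mem_filter.1 hP).2, fun P' h1 h2 =>
      hmin P' (Finset.mem_filter.2 ⟨Finset.mem_univ _, h1, h2⟩)⟩
  choose Q hQ hmin using hex
  have hnonneg : ∀ x y, ∀ e ∈ Q x y, 0 ≤ w e := fun x y e he =>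
    zero_le_one.trans (hw e ((hQ x y).1 he))
  refine ⟨Q, fun x y => (hQ x y).1, fun x y => (hQ x y).2, ⟨?_, ?_, ?_, ?_⟩, ?_⟩
  · intro x
    refine le_antisymm ?_ (Finset.sum_nonneg (hnonneg x x))
    simpa using hmin x x ∅ (by simp) (SimpleGraph.Reachable.refl x)
  · intro x y
    exact le_antisymm (hmin x y _ (hQ y x).1 (hQ y x).2.symm)
      (hmin y x _ (hQ x y).1 (hQ x y).2.symm)
  · intro x y z
    refine (hmin x z (Q x y ∪ Q y z) ?_ ?_).trans ?_
    · rw [Finset.coe_union]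
      exact Set.union_subset (hQ x y).1 (hQ y z).1
    · rw [Finset.coe_union]
      exact ((hQ x y).2.mono Set.subset_union_left).trans
        ((hQ y z).2.mono Set.subset_union_right)
    · have h1 := Finset.sum_union_inter (s₁ := Q x y) (s₂ := Q y z) (f := w)
      have h2 : 0 ≤ ∑ e ∈ Q x y ∩ Q y z, w e := Finset.sum_nonneg fun e he =>
        hnonneg x y e (Finset.mem_inter.1 he).1
      linarith
  · intro x y hxy
    have hne : (Q x y).Nonempty := by
      rw [Finset.nonempty_iff_ne_empty]
      intro h0
      have := (hQ x y).2
      rw [h0] at this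
      simp [EdgeConn] at this
      exact hxy this
    obtain ⟨e, he⟩ := hne
    exact (hw e ((hQ x y).1 he)).trans (Finset.single_le_sum (hnonneg x y) he)
  · intro u v huv
    have := hmin u v {s(u, v)} (by simpa using huv) (SimpleGraph.Adj.reachable (by
      simpa using (G.mem_edgeSet.1 huv).ne))
    simpa using this

/-- A system of root paths for the vertices of `S`: an item `e : ℕ × V` is a link from `e.2` to
`nxt e`, the links of `path v` lead from `v` to the root `r`, and the items in which the paths
of two vertices differ cost at most `K` times the distance of these vertices. -/
structure IsRootPaths {V : Type*} [DecidableEq V] (d : V → V → ℝ) (r : V) (K : ℝ) (S : Finset V)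
    (nxt : ℕ × V → V) (path : V → Finset (ℕ × V)) : Prop where
  root_mem : r ∈ S
  path_root : path r = ∅
  conn : ∀ v ∈ S, ∀ H : Set (Sym2 V), (∀ e ∈ path v, EdgeConn H e.2 (nxt e)) → EdgeConn H v r
  cost : ∀ x ∈ S, ∀ y ∈ S, ∑ e ∈ path y \ path x, d e.2 (nxt e) ≤ K * d x y

/-- Logarithmically many systems of root paths of logarithmic stretch cover all vertices. -/
lemma exists_rootPaths_cover {V : Type*} [Fintype V] [DecidableEq V] {d : V → V → ℝ}
    (hd : IsUnitDist d) (r : V) {k : ℕ} (hk : 0 < k) (hV : Fintype.card V ≤ 2 ^ k) :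
    ∃ (S : ℕ → Finset V) (nxt : ℕ → ℕ × V → V) (path : ℕ → V → Finset (ℕ × V)),
      (∀ v, ∃ j < k + 1, v ∈ S j) ∧ ∀ j, IsRootPaths d r (48 * k) (S j) (nxt j) (path j) := by
  have hk1 : (1 : ℝ) ≤ k := by exact_mod_cast hk
  have hex : ∀ U : Finset V, ∃ (S : Finset V) (nxt : ℕ × V → V) (path : V → Finset (ℕ × V)),
      2 * (U \ S).card ≤ U.card ∧ IsRootPaths d r (48 * k) S nxt path := by
    intro U
    obtain ⟨S, lev, hSU, hcard, hlev, h1, h2⟩ := exists_ultra_half hd k hk U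
      ((Finset.card_le_univ U).trans hV)
    obtain ⟨lev', hlev', h1', h2'⟩ := hlev.exists_insert hd (by linarith) h1 h2 r
    obtain ⟨nxt, path, hr, hconn, hcost⟩ :=
      hlev'.exists_paths hd h1' h2' (Finset.mem_insert_self r S)
    refine ⟨insert r S, nxt, path, ?_, Finset.mem_insert_self r S, hr, hconn, ?_⟩
    · have e1 := Finset.card_sdiff_add_card_eq_card hSU
      have e2 : (U \ insert r S).card ≤ (U \ S).card :=
        Finset.card_le_card (Finset.sdiff_subset_sdiff le_rfl (Finset.subset_insert r S))
      omega
    · intro x hx y hy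
      refine (hcost x hx y hy).trans (le_of_eq ?_)
      ring
  choose S nxt path hcard hpaths using hex
  set U : ℕ → Finset V := fun j => (fun U => U \ S U)^[j] Finset.univ with hU
  have hsucc : ∀ j, U (j + 1) = U j \ S (U j) := fun j => by
    simp only [hU, Function.iterate_succ_apply']
  have hUcard : ∀ j, (U j).card * 2 ^ j ≤ 2 ^ k := by
    intro j
    induction j with
    | zero => simpa [hU] using hV
    | succ j ih =>
      refine le_trans ?_ ih
      rw [hsucc, pow_succ]
      nlinarith [hcard (U j), Nat.two_pow_pos j]
  refine ⟨fun j => S (U j), fun j => nxt (U j), fun j => path (U j), ?_, fun j => hpaths (U j)⟩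
  intro v
  by_contra! hv
  have hmem : ∀ j ≤ k + 1, v ∈ U j := by
    intro j
    induction j with
    | zero => simp [hU]
    | succ j ih =>
      intro hj
      rw [hsucc]
      exact Finset.mem_sdiff.2 ⟨ih (by omega), hv j (by omega)⟩
  have h1 := hUcard (k + 1)
  have h2 := Finset.card_pos.2 ⟨v, hmem (k + 1) le_rfl⟩
  have h3 : 0 < 2 ^ k := Nat.two_pow_pos k
  rw [pow_succ] at h1
  nlinarith

lemma List.foldr_max_append_singleton (l : List ℝ) (a b : ℝ) :
    (l ++ [a]).foldr max b = max (l.foldr max b) a := by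
  induction l with
  | nil => exact max_comm a b
  | cons c l ih => rw [List.cons_append, List.foldr_cons, ih, List.foldr_cons, max_assoc]

lemma List.le_foldr_max (l : List ℝ) (b : ℝ) : b ≤ l.foldr max b := by
  induction l with
  | nil => exact le_rfl
  | cons c l ih => exact ih.trans (le_max_right _ _)

lemma Nat.clog_two_le_three_mul_log {n : ℕ} (hn : 2 ≤ n) :
    (Nat.clog 2 n : ℝ) ≤ 3 * Real.log n := by
  have hn0 : (2 : ℝ) ≤ n := by exact_mod_cast hn
  have h1 : (2 : ℝ) ^ (Nat.clog 2 n - 1) ≤ n := by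
    exact_mod_cast (Nat.pow_pred_clog_lt_self one_lt_two (by omega)).le
  have h2 := Real.log_le_log (by positivity) h1
  have h3 := Real.log_le_log (by norm_num) hn0
  rw [Real.log_pow, Nat.cast_sub (Nat.clog_pos one_lt_two hn)] at h2
  have := Real.log_two_gt_d9
  push_cast at h2
  nlinarith [(Nat.cast_nonneg (Nat.clog 2 n) : (0 : ℝ) ≤ Nat.clog 2 n)]

/-- There is a universal constant `C` such that every weighted graph
`G` on `n ≥ 2` vertices with root `r` admits an online group Steiner tree algorithm with
`w(H_t) ≤ C·(max_{i≤t}|gᵢ|)·log³n·OPT_t` for every request sequence and every `t`,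
i.e. an `O(N·log³n)`-competitive algorithm where `N` is the maximum group size. -/
theorem onlineGST_maxGroupSize_competitive :
    ∃ C : ℝ, 0 < C ∧
      ∀ (V : Type) [Fintype V], ∀ (G : SimpleGraph V) (w : Sym2 V → ℝ) (r : V),
        2 ≤ Fintype.card V → G.Connected → (∀ e ∈ G.edgeSet, 1 ≤ w e) →
        ∃ A : List (Set V) → Finset (Sym2 V),
          -- the solution only grows under one-step extensions
          (∀ (gs : List (Set V)) (g : Set V), GSTValid (gs ++ [g]) →
            A gs ⊆ A (gs ++ [g])) ∧
          -- feasibility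
          (∀ gs : List (Set V), GSTValid gs → GSTFeasible G r gs (A gs)) ∧
          -- competitiveness against every offline feasible solution
          (∀ gs : List (Set V), GSTValid gs → ∀ F : Finset (Sym2 V),
            GSTFeasible G r gs F →
            ∑ e ∈ A gs, w e ≤
              C * ((gs.map fun g => (g.ncard : ℝ)).foldr max 0) *
                Real.log (Fintype.card V : ℝ) ^ 3 * ∑ e ∈ F, w e) := by
  classical
  refine ⟨10368, by norm_num, ?_⟩
  intro V _ G w r hn hG hw
  obtain ⟨Q, hQG, hQconn, hd, hQle⟩ := exists_shortest_connection hG hw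
  set d : V → V → ℝ := fun x y => ∑ e ∈ Q x y, w e with hd_def
  set k := Nat.clog 2 (Fintype.card V) with hk_def
  have hk : 0 < k := Nat.clog_pos one_lt_two hn
  obtain ⟨S, nxt, path, hcover, hpaths⟩ := exists_rootPaths_cover hd r hk
    (Nat.le_pow_clog one_lt_two _)
  set c : ℕ × ℕ × V → ℝ := fun e => d e.2.2 (nxt e.1 e.2) with hc_def
  have hc : ∀ e, 0 ≤ c e := fun e => hd.nonneg _ _
  set gp : ℕ × V → Finset (ℕ × ℕ × V) := fun a => (path a.1 a.2).image (Prod.mk a.1) with hgp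
  set N : List (Set V) → ℝ := fun gs => (gs.map fun g => (g.ncard : ℝ)).foldr max 0 with hN
  have hN0 : ∀ gs, 0 ≤ N gs := fun gs => List.le_foldr_max _ _
  have hNsucc : ∀ gs g, N (gs ++ [g]) = max (N gs) g.ncard := fun gs g => by
    simp only [hN, List.map_append, List.map_cons, List.map_nil, List.foldr_max_append_singleton]
  set paths : Set V → Finset (Finset (ℕ × ℕ × V)) := fun g =>
    ((Finset.range (k + 1) ×ˢ g.toFinset).filter fun a => a.2 ∈ S a.1).image gp with hpaths_def
  set Φ : List (Set V) → Set (Finset (ℕ × ℕ × V)) := fun gs =>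
    {F | ∀ g ∈ gs, ∃ p ∈ paths g, p ⊆ F} with hΦ
  obtain ⟨A, hAmono, hA⟩ := exists_online (GSTValid (V := V))
    (fun gs B => DualPaid c (Φ gs) ((k + 1) * N gs) B ∧ B ∈ Φ gs)
    (fun l a h g hg => h g (List.mem_append_left _ hg)) ∅
    ⟨⟨fun _ => 0, 0, le_rfl, hc, by simp, by simp, by simp⟩, by simp [hΦ]⟩ (by
      rintro gs g B hv ⟨hB, hBΦ⟩
      have hg : (paths g).Nonempty := by
        obtain ⟨v, hvg⟩ := hv g (by simp)
        obtain ⟨j, hj, hvj⟩ := hcover v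
        exact ⟨gp (j, v), Finset.mem_image_of_mem _ (Finset.mem_filter.2
          ⟨Finset.mem_product.2 ⟨Finset.mem_range.2 hj, Set.mem_toFinset.2 hvg⟩, hvj⟩)⟩
      have hcard : ((paths g).card : ℝ) ≤ (k + 1) * N (gs ++ [g]) := by
        have h1 : (paths g).card ≤ (k + 1) * g.ncard := by
          refine Finset.card_image_le.trans ((Finset.card_filter_le _ _).trans (le_of_eq ?_))
          rw [Finset.card_product, Finset.card_range, Set.ncard_eq_toFinset_card']
        calc ((paths g).card : ℝ) ≤ (k + 1) * g.ncard := by exact_mod_cast h1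
          _ ≤ (k + 1) * N (gs ++ [g]) := by
            rw [hNsucc]
            gcongr
            exact le_max_right _ _
      obtain ⟨B', hBB', hB', hserve⟩ := DualPaid.exists_serve (Φ := Φ (gs ++ [g])) (paths g) hg
        hcard
        (fun F hF => hF g (by simp)) B (hB.mono (Ψ := Φ (gs ++ [g]))
          (fun F hF g' hg' => hF g' (List.mem_append_left _ hg')) (by
            rw [hNsucc]
            gcongr
            exact le_max_left _ _))
      refine ⟨B', hBB', hB', fun g' hg' => ?_⟩
      rcases List.mem_append.1 hg' with h | h
      · obtain ⟨p, hp, hpB⟩ := hBΦ g' h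
        exact ⟨p, hp, hpB.trans hBB'⟩
      · rw [List.mem_singleton.1 h]
        exact hserve)
  refine ⟨fun gs => (A gs).biUnion fun e => Q e.2.2 (nxt e.1 e.2),
    fun gs g _ => Finset.biUnion_subset_biUnion_of_subset_left _ (hAmono gs g), ?_, ?_⟩
  · intro gs hv
    refine ⟨?_, fun g hg => ?_⟩
    · intro e he
      obtain ⟨a, -, ha⟩ := Finset.mem_biUnion.1 (Finset.mem_coe.1 he)
      exact hQG _ _ ha
    · obtain ⟨p, hp, hpA⟩ := (hA gs hv).2 g hg
      obtain ⟨⟨j, v⟩, ha, rfl⟩ := Finset.mem_image.1 hp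
      obtain ⟨ha, hvj⟩ := Finset.mem_filter.1 ha
      refine ⟨v, Set.mem_toFinset.1 (Finset.mem_product.1 ha).2, r, rfl, ?_⟩
      refine (hpaths j).conn v hvj _ fun e he => ?_
      refine (hQconn e.2 (nxt j e)).mono ?_
      have := hpA (Finset.mem_image_of_mem (Prod.mk j) he)
      exact_mod_cast Finset.subset_biUnion_of_mem
        (fun e : ℕ × ℕ × V => Q e.2.2 (nxt e.1 e.2)) this
  · intro gs hv F hF
    have hw0 : ∀ e ∈ F, 0 ≤ w e := fun e he => zero_le_one.trans (hw e (hF.1 he))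
    obtain ⟨l, hl, hlen⟩ := exists_tour hd F hw0 (fun u v h => hQle u v (hF.1 h)) r
    set T : ℕ → Finset (ℕ × V) := fun j => ((r :: l).toFinset ∩ S j).biUnion (path j) with hT
    have hTcost : ∀ j, ∑ e ∈ T j, d e.2 (nxt j e) ≤ 48 * k * (2 * ∑ e ∈ F, w e) := by
      intro j
      have h := sum_biUnion_le_tourLength hd (c := fun e => d e.2 (nxt j e))
        (fun e => hd.nonneg _ _) (by positivity) (hpaths j).cost (r :: l) r r (hpaths j).root_mem
      rw [(hpaths j).path_root, Finset.sdiff_empty, tourLength, hd.self, zero_add, zero_add] at h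
      exact h.trans (by gcongr)
    set F' : Finset (ℕ × ℕ × V) := (Finset.range (k + 1)).biUnion fun j =>
      (T j).image (Prod.mk j) with hF'
    have hF'mem : F' ∈ Φ gs := by
      intro g hg
      obtain ⟨v, hvg, r', hr', hconn⟩ := hF.2 g hg
      rw [Set.mem_singleton_iff.1 hr'] at hconn
      obtain ⟨j, hj, hvj⟩ := hcover v
      refine ⟨gp (j, v), Finset.mem_image_of_mem _ (Finset.mem_filter.2
          ⟨Finset.mem_product.2 ⟨Finset.mem_range.2 hj, Set.mem_toFinset.2 hvg⟩, hvj⟩), ?_⟩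
      refine subset_trans (Finset.image_subset_image ?_) (Finset.subset_biUnion_of_mem
        (fun j => (T j).image (Prod.mk j)) (Finset.mem_range.2 hj))
      exact Finset.subset_biUnion_of_mem (path j)
        (Finset.mem_inter.2 ⟨List.mem_toFinset.2 (hl v hconn), hvj⟩)
    have hF'cost : ∑ e ∈ F', c e ≤ (k + 1) * (48 * k * (2 * ∑ e ∈ F, w e)) := by
      refine (Finset.sum_biUnion_le_sum _ _ _ fun _ _ e _ => hc e).trans ?_
      calc _ ≤ ∑ j ∈ Finset.range (k + 1), 48 * k * (2 * ∑ e ∈ F, w e) := by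
            refine Finset.sum_le_sum fun j _ => ?_
            rw [Finset.sum_image fun a _ b _ h => (Prod.mk.inj h).2]
            exact hTcost j
        _ = _ := by
            rw [Finset.sum_const, Finset.card_range, nsmul_eq_mul]
            push_cast
            ring
    have hW : 0 ≤ ∑ e ∈ F, w e := Finset.sum_nonneg hw0
    have hk1 : (1 : ℝ) ≤ k := by exact_mod_cast hk
    have hklog : (k : ℝ) ≤ 3 * Real.log (Fintype.card V) := Nat.clog_two_le_three_mul_log hn
    calc ∑ e ∈ (A gs).biUnion fun e => Q e.2.2 (nxt e.1 e.2), w e ≤ ∑ e ∈ A gs, c e :=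
          Finset.sum_biUnion_le_sum _ _ _ fun a _ e he =>
            zero_le_one.trans (hw e (hQG _ _ he))
      _ ≤ (k + 1) * N gs * ∑ e ∈ F', c e :=
          (hA gs hv).1.sum_le (mul_nonneg (by positivity) (hN0 gs)) hF'mem
      _ ≤ (k + 1) * N gs * ((k + 1) * (48 * k * (2 * ∑ e ∈ F, w e))) :=
          mul_le_mul_of_nonneg_left hF'cost (mul_nonneg (by positivity) (hN0 gs))
      _ = 96 * ((k + 1) ^ 2 * k) * (N gs * ∑ e ∈ F, w e) := by ring
      _ ≤ 96 * ((2 * k) ^ 2 * k) * (N gs * ∑ e ∈ F, w e) := by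
          have := mul_nonneg (hN0 gs) hW
          gcongr
          linarith
      _ = 384 * (k : ℝ) ^ 3 * (N gs * ∑ e ∈ F, w e) := by ring
      _ ≤ 384 * (3 * Real.log (Fintype.card V)) ^ 3 * (N gs * ∑ e ∈ F, w e) := by
          have := mul_nonneg (hN0 gs) hW
          gcongr
      _ = 10368 * N gs * Real.log (Fintype.card V) ^ 3 * ∑ e ∈ F, w e := by ring
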